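/- arXiv:1812.08461 — 6 statements merged into one kernel-verified Lean document; each statement's English description precedes it below -/
import Mathlib

section
/- For all smooth coefficient maps a and b, the polarized Hamiltonian vector field X_{a,b} satisfies i(X_{a,b})θ = −dH_{a,b}: for every m ∈ E, every v ∈ E and every p ∈ Fin k, θ_p(X_{a,b}(m), v) = −(fderiv ℝ (fun m => H_{a,b}(m) p) m) v. -/
noncomputable section

/-- The model polarized k-symplectic space `E = (ℝ^n)^k × ℝ^n`. -/
abbrev E (k n : ℕ) : Type := (Fin k → Fin n → ℝ) × (Fin n → ℝ)

/-- The components `θ_p` of the canonical polarized k-symplectic form: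
`θ_p((x,y),(x',y')) = Σ_i (x p i * y' i − x' p i * y i)`. -/
def theta (k n : ℕ) (p : Fin k) (w v : E k n) : ℝ :=
  ∑ i, (w.1 p i * v.2 i - v.1 p i * w.2 i)

/-- The polarized Hamiltonian `H_{a,b}(x,y) p = Σ_j a j (y) * x p j + b p (y)`. -/
def Ham {k n : ℕ} (a : (Fin n → ℝ) → (Fin n → ℝ)) (b : (Fin n → ℝ) → (Fin k → ℝ))
    (m : E k n) : Fin k → ℝ :=
  fun p => ∑ j, a m.2 j * m.1 p j + b m.2 p

/-- The polarized Hamiltonian vector field `X_{a,b}`, with first component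
`(p,s) ↦ −(Σ_j x p j * ∂a_j/∂y_s(y) + ∂b_p/∂y_s(y))` and second component `i ↦ a i (y)`. -/
def HamVF {k n : ℕ} (a : (Fin n → ℝ) → (Fin n → ℝ)) (b : (Fin n → ℝ) → (Fin k → ℝ))
    (m : E k n) : E k n :=
  (fun p s => -((∑ j, m.1 p j * fderiv ℝ a m.2 (Pi.single s 1) j)
      + fderiv ℝ b m.2 (Pi.single s 1) p),
   fun i => a m.2 i)

/-- The Lie bracket of vector fields `[X,Y](m) = (fderiv ℝ Y m)(X m) − (fderiv ℝ X m)(Y m)`. -/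
def lieBracketVF {k n : ℕ} (X Y : E k n → E k n) (m : E k n) : E k n :=
  fderiv ℝ Y m (X m) - fderiv ℝ X m (Y m)

/-- A continuous linear map on `ℝ^n` is recovered from its values on the standard basis. -/
theorem ContinuousLinearMap.sum_mul_apply_single {k n : ℕ}
    (L : (Fin n → ℝ) →L[ℝ] (Fin k → ℝ)) (w : Fin n → ℝ) (j : Fin k) :
    ∑ s, w s * L (Pi.single s 1) j = L w j := by
  conv_rhs => rw [pi_eq_sum_univ' w]
  simp [Finset.sum_apply]

/-- The differential of a component of the polarized Hamiltonian. -/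
theorem fderiv_ham_apply {k n : ℕ} {a : (Fin n → ℝ) → (Fin n → ℝ)}
    {b : (Fin n → ℝ) → (Fin k → ℝ)} {m : E k n} (ha : DifferentiableAt ℝ a m.2)
    (hb : DifferentiableAt ℝ b m.2) (v : E k n) (p : Fin k) :
    fderiv ℝ (fun m => Ham a b m p) m v =
      ∑ j, (a m.2 j * v.1 p j + m.1 p j * fderiv ℝ a m.2 v.2 j) + fderiv ℝ b m.2 v.2 p := by
  have hsnd : HasFDerivAt (fun m : E k n => m.2) (ContinuousLinearMap.snd ℝ _ _) m :=
    hasFDerivAt_snd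
  have hA (j : Fin n) := hasFDerivAt_pi'.1 (ha.hasFDerivAt.comp m hsnd) j
  have hB := hasFDerivAt_pi'.1 (hb.hasFDerivAt.comp m hsnd) p
  have hX (j : Fin n) := hasFDerivAt_pi'.1 (hasFDerivAt_pi'.1
    (hasFDerivAt_fst (𝕜 := ℝ) (p := m)) p) j
  have hH := (HasFDerivAt.fun_sum (u := Finset.univ) fun j _ => (hA j).mul (hX j)).add hB
  have hH' : HasFDerivAt (fun m => Ham a b m p) _ m := hH
  rw [hH'.fderiv]
  simp

/-- `i(X_{a,b})θ = −dH_{a,b}`. -/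
theorem hamVF_contraction (k n : ℕ) (hk : 1 ≤ k) (hn : 1 ≤ n)
    (a : (Fin n → ℝ) → (Fin n → ℝ)) (b : (Fin n → ℝ) → (Fin k → ℝ))
    (ha : ContDiff ℝ (⊤ : ℕ∞) a) (hb : ContDiff ℝ (⊤ : ℕ∞) b) :
    ∀ (m v : E k n) (p : Fin k),
      theta k n p (HamVF a b m) v = -(fderiv ℝ (fun m => Ham a b m p) m) v := by
  intro m v p
  rw [fderiv_ham_apply (ha.differentiable (by simp) _) (hb.differentiable (by simp) _),
    ← ContinuousLinearMap.sum_mul_apply_single (fderiv ℝ b m.2)]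
  simp only [← ContinuousLinearMap.sum_mul_apply_single (fderiv ℝ a m.2) v.2]
  simp only [theta, HamVF, Finset.sum_add_distrib, Finset.sum_sub_distrib, Finset.mul_sum,
    neg_mul, add_mul, Finset.sum_mul, Finset.sum_neg_distrib]
  rw [Finset.sum_comm]
  simp only [mul_comm, mul_left_comm]
  ring
end
end

section
/- The polarized Hamiltonian vector field is unique: if a, b are smooth and a map X : E → E satisfies θ_p(X(m), v) = −(fderiv ℝ (fun m => H_{a,b}(m) p) m) v for every m ∈ E, every v ∈ E and every p ∈ Fin k, then X = X_{a,b}. -/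
noncomputable section

/-- The derivative of a component of the polarized Hamiltonian, by the product rule. -/
theorem fderiv_Ham_apply {k n : ℕ} {a : (Fin n → ℝ) → (Fin n → ℝ)}
    {b : (Fin n → ℝ) → (Fin k → ℝ)} {m : E k n} (ha : DifferentiableAt ℝ a m.2)
    (hb : DifferentiableAt ℝ b m.2) (p : Fin k) (v : E k n) :
    fderiv ℝ (fun m => Ham a b m p) m v =
      ∑ j, (a m.2 j * v.1 p j + m.1 p j * fderiv ℝ a m.2 v.2 j) + fderiv ℝ b m.2 v.2 p := by
  have hx (j : Fin n) :=
    ((ContinuousLinearMap.proj (R := ℝ) (φ := fun _ : Fin n => ℝ) j).comp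
      ((ContinuousLinearMap.proj (R := ℝ) (φ := fun _ : Fin k => Fin n → ℝ) p).comp
        (ContinuousLinearMap.fst ℝ (Fin k → Fin n → ℝ) (Fin n → ℝ)))).hasFDerivAt (x := m)
  have hy : HasFDerivAt (fun m : E k n => m.2) (ContinuousLinearMap.snd ℝ _ _) m := hasFDerivAt_snd
  have hA := hasFDerivAt_pi'.1 (ha.hasFDerivAt.comp m hy)
  have hB := hasFDerivAt_pi'.1 (hb.hasFDerivAt.comp m hy)
  have h := (HasFDerivAt.fun_sum (u := Finset.univ) fun j _ => (hA j).mul (hx j)).add (hB p)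
  have h' : HasFDerivAt (fun m => Ham a b m p) _ m := h
  rw [h'.fderiv]
  simp

/-- uniqueness of the polarized Hamiltonian vector field. -/
theorem hamVF_unique (k n : ℕ) (hk : 1 ≤ k) (hn : 1 ≤ n)
    (a : (Fin n → ℝ) → (Fin n → ℝ)) (b : (Fin n → ℝ) → (Fin k → ℝ))
    (ha : ContDiff ℝ (⊤ : ℕ∞) a) (hb : ContDiff ℝ (⊤ : ℕ∞) b)
    (X : E k n → E k n)
    (hX : ∀ (m v : E k n) (p : Fin k),
      theta k n p (X m) v = -(fderiv ℝ (fun m => Ham a b m p) m) v) :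
    X = HamVF a b := by
  funext m
  have key (v : E k n) (p : Fin k) := (hX m v p).trans <| congrArg Neg.neg <|
    fderiv_Ham_apply (ha.differentiable (by simp) m.2) (hb.differentiable (by simp) m.2) p v
  refine Prod.ext (funext₂ fun p s => ?_) (funext fun i => ?_)
  · simpa [theta, HamVF, Pi.single_apply] using key (0, Pi.single s 1) p
  · simpa [theta, HamVF, Pi.single_apply] using key (Pi.single ⟨0, hk⟩ (Pi.single i 1), 0) ⟨0, hk⟩
end
end

section
/- Local form of polarized Hamiltonians: let H : E → (Fin k → ℝ) be smooth and suppose there exists a map X : E → E which is foliate (its second component factors through y, i.e. there is ξ : (Fin n → ℝ) → (Fin n → ℝ) with (X(x, y)).2 = ξ(y) for all (x, y)) and which satisfies θ_p(X(m), v) = −(fderiv ℝ (fun m => H(m) p) m) v for all m, v ∈ E and p ∈ Fin k. Then there exist smooth maps a : (Fin n → ℝ) → (Fin n → ℝ) and b : (Fin n → ℝ) → (Fin k → ℝ) such that H(x, y) p = Σ_j a j (y) * x p j + b p (y) for all (x, y) ∈ E and p ∈ Fin k; in particular H is affine in x with x-coefficients independent of p. -/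
noncomputable section

/-- local form of polarized Hamiltonians. -/
theorem ham_local_form (k n : ℕ) (hk : 1 ≤ k) (hn : 1 ≤ n)
    (H : E k n → (Fin k → ℝ)) (hH : ContDiff ℝ (⊤ : ℕ∞) H)
    (X : E k n → E k n)
    (hfol : ∃ ξ : (Fin n → ℝ) → (Fin n → ℝ), ∀ m : E k n, (X m).2 = ξ m.2)
    (hXH : ∀ (m v : E k n) (p : Fin k),
      theta k n p (X m) v = -(fderiv ℝ (fun m => H m p) m) v) :
    ∃ (a : (Fin n → ℝ) → (Fin n → ℝ)) (b : (Fin n → ℝ) → (Fin k → ℝ)),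
      ContDiff ℝ (⊤ : ℕ∞) a ∧ ContDiff ℝ (⊤ : ℕ∞) b ∧
      ∀ (m : E k n) (p : Fin k), H m p = ∑ j, a m.2 j * m.1 p j + b m.2 p := by
  obtain ⟨ξ, hξ⟩ := hfol
  have key : ∀ (m : E k n) (p : Fin k),
      H m p = ∑ j, ξ m.2 j * m.1 p j + H (0, m.2) p := by
    rintro ⟨x, y⟩ p
    have hHp : Differentiable ℝ (fun m => H m p) :=
      (contDiff_pi.1 hH p).differentiable (by simp)
    have hγ : ∀ t : ℝ, HasDerivAt (fun t : ℝ => ((t • x, y) : E k n)) (x, 0) t := fun t => by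
      simpa using ((hasDerivAt_id t).smul_const x).prodMk (hasDerivAt_const t y)
    have hd : ∀ t : ℝ, HasDerivAt (fun t : ℝ => H (t • x, y) p - t * ∑ j, ξ y j * x p j) 0 t := by
      intro t
      have h1 := (hHp (t • x, y)).hasFDerivAt.comp_hasDerivAt t (hγ t)
      have h2 : fderiv ℝ (fun m => H m p) (t • x, y) (x, 0) = ∑ j, ξ y j * x p j := by
        have h := hXH (t • x, y) (x, 0) p
        simp only [theta, hξ, Pi.zero_apply, mul_zero, zero_sub, Finset.sum_neg_distrib,
          neg_inj] at h
        rw [← h]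
        exact Finset.sum_congr rfl fun j _ => mul_comm _ _
      rw [h2] at h1
      have h3 := h1.sub ((hasDerivAt_id t).mul_const (∑ j, ξ y j * x p j))
      rw [one_mul, sub_self] at h3
      exact h3
    have hc := is_const_of_deriv_eq_zero (fun t => (hd t).differentiableAt)
      (fun t => (hd t).deriv) 1 0
    simp only [one_smul, zero_smul, one_mul, zero_mul, sub_zero] at hc
    linarith
  have hslice : ∀ x : Fin k → Fin n → ℝ, ContDiff ℝ (⊤ : ℕ∞) fun y => H (x, y) :=
    fun x => hH.comp (contDiff_const.prodMk contDiff_id)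
  refine ⟨ξ, fun y => H (0, y), ?_, hslice 0, key⟩
  refine contDiff_pi.2 fun j => ?_
  let p : Fin k := ⟨0, hk⟩
  have hξj : (fun y => ξ y j) =
      fun y => H (fun _ => Pi.single j 1, y) p - H (0, y) p := by
    funext y
    rw [key (fun _ => Pi.single j 1, y) p]
    simp [Pi.single_apply]
  rw [hξj]
  exact (contDiff_pi.1 (hslice _) p).sub (contDiff_pi.1 (hslice 0) p)
end
end

section
/- If two polarized Hamiltonians have the same Hamiltonian vector field, they differ by a constant: if a, b, a', b' are smooth and X_{a,b} = X_{a',b'}, then there is a constant c ∈ (Fin k → ℝ) with H_{a,b}(m) = H_{a',b'}(m) + c for all m ∈ E. -/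
noncomputable section

/-- Two differentiable maps on `ℝ^n` with the same partial derivatives differ by a constant. -/
theorem exists_eq_add_of_fderiv_single_eq {n : ℕ} {F : Type*} [NormedAddCommGroup F]
    [NormedSpace ℝ F] {f g : (Fin n → ℝ) → F} (hf : Differentiable ℝ f)
    (hg : Differentiable ℝ g)
    (h : ∀ y s, fderiv ℝ f y (Pi.single s 1) = fderiv ℝ g y (Pi.single s 1)) :
    ∃ c : F, ∀ y, f y = g y + c := by
  have hfg : ∀ y, fderiv ℝ f y = fderiv ℝ g y := fun y =>
    ContinuousLinearMap.coe_injective <|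
      (Pi.basisFun ℝ (Fin n)).ext fun s => by simpa using h y s
  have hzero : ∀ y, fderiv ℝ (f - g) y = 0 := fun y => by
    rw [fderiv_sub (hf y) (hg y), hfg, sub_self]
  refine ⟨f 0 - g 0, fun y => ?_⟩
  have hy : f y - g y = f 0 - g 0 := is_const_of_fderiv_eq_zero (hf.sub hg) hzero y 0
  rw [← hy, add_sub_cancel]

/-- Hamiltonians with the same Hamiltonian vector field differ by a constant. -/
theorem ham_eq_up_to_constant (k n : ℕ) (hk : 1 ≤ k) (hn : 1 ≤ n)
    (a a' : (Fin n → ℝ) → (Fin n → ℝ)) (b b' : (Fin n → ℝ) → (Fin k → ℝ))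
    (ha : ContDiff ℝ (⊤ : ℕ∞) a) (hb : ContDiff ℝ (⊤ : ℕ∞) b)
    (ha' : ContDiff ℝ (⊤ : ℕ∞) a') (hb' : ContDiff ℝ (⊤ : ℕ∞) b')
    (hXX : HamVF a b = HamVF a' b') :
    ∃ c : Fin k → ℝ, ∀ m : E k n, Ham a b m = Ham a' b' m + c := by
  have haa : a = a' := funext fun y => congrArg Prod.snd (congrFun hXX (0, y))
  obtain ⟨c, hc⟩ := exists_eq_add_of_fderiv_single_eq (hb.differentiable (by simp))
    (hb'.differentiable (by simp)) fun y s => funext fun p => by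
      simpa [HamVF] using congrFun (congrFun (congrArg Prod.fst (congrFun hXX (0, y))) p) s
  refine ⟨c, fun m => funext fun p => ?_⟩
  simp [Ham, haa, hc, add_assoc]
end
end

section
/- The bracket of two locally Hamiltonian vector fields is Hamiltonian: let X, Y : E → E be smooth and suppose that for each p ∈ Fin k the 1-forms m ↦ θ_p(X(m), ·) and m ↦ θ_p(Y(m), ·) are closed, i.e. θ_p((fderiv ℝ X m) u, v) = θ_p((fderiv ℝ X m) v, u) and θ_p((fderiv ℝ Y m) u, v) = θ_p((fderiv ℝ Y m) v, u) for all m, u, v ∈ E. Then for all m, v ∈ E and p ∈ Fin k: θ_p([X, Y](m), v) = −(fderiv ℝ (fun m => θ_p(X(m), Y(m))) m) v; that is, i([X, Y])θ = −d(θ(X, Y)) is exact. -/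
noncomputable section

theorem theta_isBilinearMap (k n : ℕ) (p : Fin k) : IsBilinearMap ℝ (theta k n p) where
  add_left u v w := by
    simp only [theta, ← Finset.sum_add_distrib, Prod.fst_add, Prod.snd_add, Pi.add_apply]
    exact Finset.sum_congr rfl fun i _ => by ring
  smul_left c u w := by
    simp only [theta, Prod.smul_fst, Prod.smul_snd, Pi.smul_apply, smul_eq_mul,
      Finset.mul_sum]
    exact Finset.sum_congr rfl fun i _ => by ring
  add_right u v w := by
    simp only [theta, ← Finset.sum_add_distrib, Prod.fst_add, Prod.snd_add, Pi.add_apply]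
    exact Finset.sum_congr rfl fun i _ => by ring
  smul_right c u w := by
    simp only [theta, Prod.smul_fst, Prod.smul_snd, Pi.smul_apply, smul_eq_mul,
      Finset.mul_sum]
    exact Finset.sum_congr rfl fun i _ => by ring

theorem theta_antisymm (k n : ℕ) (p : Fin k) (u v : E k n) :
    theta k n p u v = -theta k n p v u := by
  simp only [theta, ← Finset.sum_neg_distrib, neg_sub]

theorem theta_sub_left (k n : ℕ) (p : Fin k) (u v w : E k n) :
    theta k n p (u - v) w = theta k n p u w - theta k n p v w :=
  (theta_isBilinearMap k n p).toLinearMap.map_sub₂ u v w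

theorem fderiv_theta_apply {k n : ℕ} (p : Fin k) {X Y : E k n → E k n} {m : E k n}
    (hX : DifferentiableAt ℝ X m) (hY : DifferentiableAt ℝ Y m) (v : E k n) :
    fderiv ℝ (fun m => theta k n p (X m) (Y m)) m v
      = theta k n p (X m) (fderiv ℝ Y m v) + theta k n p (fderiv ℝ X m v) (Y m) :=
  DFunLike.congr_fun ((theta_isBilinearMap k n p).toContinuousBilinearMap.fderiv_of_bilinear
    hX hY) v

/-- the bracket of two locally Hamiltonian vector fields is Hamiltonian,
with Hamiltonian `θ(X, Y)`: `i([X,Y])θ = −d(θ(X,Y))`. -/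
theorem lieBracket_isHamiltonian (k n : ℕ) (hk : 1 ≤ k) (hn : 1 ≤ n)
    (X Y : E k n → E k n) (hX : ContDiff ℝ (⊤ : ℕ∞) X) (hY : ContDiff ℝ (⊤ : ℕ∞) Y)
    (hXclosed : ∀ (m u v : E k n) (p : Fin k),
      theta k n p (fderiv ℝ X m u) v = theta k n p (fderiv ℝ X m v) u)
    (hYclosed : ∀ (m u v : E k n) (p : Fin k),
      theta k n p (fderiv ℝ Y m u) v = theta k n p (fderiv ℝ Y m v) u) :
    ∀ (m v : E k n) (p : Fin k),
      theta k n p (lieBracketVF X Y m) v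
        = -(fderiv ℝ (fun m => theta k n p (X m) (Y m)) m) v := by
  intro m v p
  rw [fderiv_theta_apply p (hX.differentiable (by simp) m) (hY.differentiable (by simp) m),
    lieBracketVF, theta_sub_left, hYclosed, hXclosed, theta_antisymm k n p (X m)]
  ring
end
end

section
/- The polarized Poisson bracket of two polarized Hamiltonians is again a polarized Hamiltonian, with explicit coefficients: for smooth a, b, a', b', the function m ↦ −θ(X_{a,b}(m), X_{a',b'}(m)) (components p ↦ −θ_p(X_{a,b}(m), X_{a',b'}(m))) equals H_{â,b̂}, where â j (y) = Σ_i ( a' i (y) · ∂a_j/∂y_i(y) − a i (y) · ∂a'_j/∂y_i(y) ) and b̂ p (y) = Σ_i ( a' i (y) · ∂b_p/∂y_i(y) − a i (y) · ∂b'_p/∂y_i(y) ). -/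
noncomputable section

/-- x-coefficients of the polarized Poisson bracket `{H_{a,b}, H_{a',b'}}`. -/
def pbA {n : ℕ} (a a' : (Fin n → ℝ) → (Fin n → ℝ)) : (Fin n → ℝ) → (Fin n → ℝ) :=
  fun y j => ∑ i, (a' y i * fderiv ℝ a y (Pi.single i 1) j
    - a y i * fderiv ℝ a' y (Pi.single i 1) j)

/-- y-coefficients of the polarized Poisson bracket `{H_{a,b}, H_{a',b'}}`. -/
def pbB {k n : ℕ} (a : (Fin n → ℝ) → (Fin n → ℝ)) (b : (Fin n → ℝ) → (Fin k → ℝ))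
    (a' : (Fin n → ℝ) → (Fin n → ℝ)) (b' : (Fin n → ℝ) → (Fin k → ℝ)) :
    (Fin n → ℝ) → (Fin k → ℝ) :=
  fun y p => ∑ i, (a' y i * fderiv ℝ b y (Pi.single i 1) p
    - a y i * fderiv ℝ b' y (Pi.single i 1) p)

/-- the polarized Poisson bracket of two polarized Hamiltonians is again a
polarized Hamiltonian, with explicit coefficients. -/
theorem poisson_bracket_is_ham (k n : ℕ) (hk : 1 ≤ k) (hn : 1 ≤ n)
    (a a' : (Fin n → ℝ) → (Fin n → ℝ)) (b b' : (Fin n → ℝ) → (Fin k → ℝ))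
    (ha : ContDiff ℝ (⊤ : ℕ∞) a) (hb : ContDiff ℝ (⊤ : ℕ∞) b)
    (ha' : ContDiff ℝ (⊤ : ℕ∞) a') (hb' : ContDiff ℝ (⊤ : ℕ∞) b') :
    (fun (m : E k n) (p : Fin k) => -theta k n p (HamVF a b m) (HamVF a' b' m))
      = Ham (pbA a a') (pbB a b a' b') := by
  funext m p
  simp only [theta, HamVF, Ham, pbA, pbB, Finset.sum_mul]
  rw [Finset.sum_comm, ← Finset.sum_add_distrib, ← Finset.sum_neg_distrib]
  refine Finset.sum_congr rfl fun i _ => ?_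
  simp only [sub_mul, Finset.sum_sub_distrib, mul_assoc, ← Finset.mul_sum,
    mul_comm (m.1 p _)]
  ring
end
end
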